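/- arXiv:2512.22362 — 6 statements merged into one kernel-verified Lean document; each statement's English description precedes it below -/
import Mathlib

section
/- For every natural number n ≥ 1, C_B(n) = 3^(3n−2) − ((1 + (−1)^n) + i·√3·(1 − (−1)^n))·(i^n/2)·3^((3n−2)/2); equivalently, in real terms: if n is even then C_B(n) = 3^(3n−2) − (−1)^(n/2)·3^((3n−2)/2), and if n is odd then C_B(n) = 3^(3n−2) − (−1)^((n+1)/2)·3^((3n−1)/2). -/
open Nat Finset

/-- `CB n` is the number of words of length `3n` over a three-letter alphabet in which
each letter occurs a number of times congruent to 1 mod 3: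
the sum over triples `k1 + k2 + k3 = n - 1` of `(3n)! / ((3k1+1)! (3k2+1)! (3k3+1)!)`,
with `CB 0 = 0`. -/
def CB (n : ℕ) : ℕ :=
  if n = 0 then 0 else
    ∑ k ∈ Finset.Nat.antidiagonalTuple 3 (n - 1),
      (3 * n)! / ((3 * k 0 + 1)! * (3 * k 1 + 1)! * (3 * k 2 + 1)!)

/-- The filter on exponents congruent to `1` modulo `3` given by a primitive cube root of unity. -/
lemma sum_range_three_pow_mul_add_two {R : Type*} [CommRing R] {ω : R} (hω : ω ^ 2 + ω + 1 = 0)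
    (a : ℕ) : ∑ s ∈ range 3, ω ^ (s * (a + 2)) = if a % 3 = 1 then 3 else 0 := by
  have h3 : ω ^ 3 = 1 := by linear_combination (ω - 1) * hω
  have h : ∀ s, ω ^ (s * (a + 2)) = ω ^ (s * (a % 3 + 2)) := by
    intro s
    conv_lhs => rw [← Nat.mod_add_div a 3]
    rw [show s * (a % 3 + 3 * (a / 3) + 2) = s * (a % 3 + 2) + 3 * (s * (a / 3)) by ring,
      pow_add, pow_mul ω 3, h3, one_pow, mul_one]
  simp only [h, sum_range_succ, range_zero, sum_empty]
  have : a % 3 < 3 := Nat.mod_lt _ (by norm_num)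
  interval_cases a % 3
  · simp
    linear_combination (ω ^ 2 - ω + 1) * hω
  · simp
    linear_combination (1 + (ω ^ 3 + 1)) * h3
  · simp
    linear_combination (ω ^ 6 - ω ^ 5 + ω ^ 3 - ω + 1) * hω

lemma CB_eq_sum_multinomial (n : ℕ) (hn : 1 ≤ n) :
    CB n = ∑ k ∈ piAntidiag (univ : Finset (Fin 3)) (3 * n),
      if k 0 % 3 = 1 ∧ k 1 % 3 = 1 then Nat.multinomial univ k else 0 := by
  rw [CB, if_neg (by omega)]
  refine sum_of_injOn (fun k i => 3 * k i + 1) ?_ ?_ ?_ ?_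
  · intro k _ l _ h
    funext i
    have := congrFun h i
    simp only at this
    omega
  · intro k hk
    simp only [mem_coe, Finset.Nat.mem_antidiagonalTuple, Fin.sum_univ_three] at hk
    simp only [mem_coe, mem_piAntidiag, Fin.sum_univ_three]
    exact ⟨by omega, by simp⟩
  · intro k hk hk'
    refine if_neg fun h => hk' ⟨fun i => k i / 3, ?_, ?_⟩
    all_goals simp only [mem_piAntidiag, Fin.sum_univ_three] at hk
    · simp only [mem_coe, Finset.Nat.mem_antidiagonalTuple, Fin.sum_univ_three]
      omega
    · funext i
      fin_cases i <;> simp <;> omega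
  · intro k hk
    simp only [Finset.Nat.mem_antidiagonalTuple, Fin.sum_univ_three] at hk
    rw [if_pos (by dsimp only; omega), Nat.multinomial, Fin.sum_univ_three, Fin.prod_univ_three]
    congr 2
    omega

lemma nine_mul_CB {R : Type*} [CommRing R] {ω : R} (hω : ω ^ 2 + ω + 1 = 0)
    (n : ℕ) (hn : 1 ≤ n) :
    9 * (CB n : R) = ∑ s ∈ range 3, ∑ t ∈ range 3,
      ω ^ (s * 2) * ω ^ (t * 2) * (ω ^ s + ω ^ t + 1) ^ (3 * n) := by
  have expand : ∀ s t : ℕ, (ω ^ s + ω ^ t + 1) ^ (3 * n) =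
      ∑ k ∈ piAntidiag (univ : Finset (Fin 3)) (3 * n),
        (Nat.multinomial univ k : R) * (ω ^ (s * k 0) * ω ^ (t * k 1)) := by
    intro s t
    have := sum_pow_eq_sum_piAntidiag (univ : Finset (Fin 3)) ![ω ^ s, ω ^ t, 1] (3 * n)
    simpa [Fin.sum_univ_three, Fin.prod_univ_three, ← pow_mul] using this
  simp_rw [expand, mul_sum]
  rw [sum_congr rfl fun s _ => sum_comm, sum_comm, CB_eq_sum_multinomial n hn, Nat.cast_sum,
    mul_sum]
  refine sum_congr rfl fun k _ => ?_
  have hfactor : ∑ s ∈ range 3, ∑ t ∈ range 3, ω ^ (s * 2) * ω ^ (t * 2) *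
      ((Nat.multinomial univ k : R) * (ω ^ (s * k 0) * ω ^ (t * k 1))) =
      Nat.multinomial univ k * ((∑ s ∈ range 3, ω ^ (s * (k 0 + 2))) *
        ∑ t ∈ range 3, ω ^ (t * (k 1 + 2))) := by
    rw [sum_mul_sum, mul_sum]
    refine sum_congr rfl fun s _ => ?_
    rw [mul_sum]
    refine sum_congr rfl fun t _ => ?_
    ring
  rw [hfactor, sum_range_three_pow_mul_add_two hω, sum_range_three_pow_mul_add_two hω]
  by_cases h0 : k 0 % 3 = 1 <;> by_cases h1 : k 1 % 3 = 1 <;> simp [h0, h1]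
  ring

lemma nine_mul_CB_eq {R : Type*} [CommRing R] {ω : R} (hω : ω ^ 2 + ω + 1 = 0)
    (n : ℕ) (hn : 1 ≤ n) :
    9 * (CB n : R) = 27 ^ n +
      3 * (ω ^ 2 * (3 * (1 + 2 * ω)) ^ n + ω * (-(3 * (1 + 2 * ω))) ^ n) := by
  have h3 : ω ^ 3 = 1 := by linear_combination (ω - 1) * hω
  have h8 : ω ^ 8 = ω ^ 2 := by linear_combination (ω ^ 5 + ω ^ 2) * h3
  have h4 : ω ^ 4 = ω := by linear_combination ω * h3
  have e0 : (1 + 1 + 1 : R) ^ 3 = 27 := by norm_num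
  have e1 : (1 + ω + 1) ^ 3 = 3 * (1 + 2 * ω) := by linear_combination (ω + 5) * hω
  have e1' : (ω + 1 + 1) ^ 3 = 3 * (1 + 2 * ω) := by linear_combination (ω + 5) * hω
  have e2 : (1 + ω ^ 2 + 1) ^ 3 = -(3 * (1 + 2 * ω)) := by
    linear_combination (ω ^ 4 - ω ^ 3 + 6 * ω ^ 2 - 5 * ω + 11) * hω
  have e2' : (ω ^ 2 + 1 + 1) ^ 3 = -(3 * (1 + 2 * ω)) := by
    linear_combination (ω ^ 4 - ω ^ 3 + 6 * ω ^ 2 - 5 * ω + 11) * hω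
  have e3 : (ω + ω + 1) ^ 3 = -(3 * (1 + 2 * ω)) := by linear_combination (8 * ω + 4) * hω
  have e4 : (ω ^ 2 + ω ^ 2 + 1) ^ 3 = 3 * (1 + 2 * ω) := by
    linear_combination (8 * ω ^ 4 - 8 * ω ^ 3 + 12 * ω ^ 2 - 4 * ω - 2) * hω
  have e5 : (ω + ω ^ 2 + 1) ^ 3 = 0 := by
    rw [show ω + ω ^ 2 + 1 = 0 by linear_combination hω]; simp
  have e5' : (ω ^ 2 + ω + 1) ^ 3 = 0 := by rw [hω]; simp
  rw [nine_mul_CB hω n hn]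
  simp only [sum_range_succ, range_zero, sum_empty, pow_mul _ 3 n, pow_zero, pow_one, zero_mul,
    one_mul, e0, e1, e1', e2, e2', e3, e4, e5, e5', zero_pow (by omega : n ≠ 0), ← pow_add]
  norm_num [h4, h8]
  ring

lemma exists_sq_add_self_add_one_eq_zero : ∃ ω : ℂ, ω ^ 2 + ω + 1 = 0 := by
  refine ⟨(-1 + Complex.I * Real.sqrt 3) / 2, ?_⟩
  have h : (Real.sqrt 3 : ℂ) ^ 2 = 3 := by
    exact_mod_cast Real.sq_sqrt (show (0 : ℝ) ≤ 3 by norm_num)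
  linear_combination (1 / 4 : ℂ) * (Real.sqrt 3 : ℂ) ^ 2 * Complex.I_sq - (1 / 4 : ℂ) * h

lemma CB_two_mul_add_two (m : ℕ) :
    (CB (2 * m + 2) : ℤ) = 3 ^ (6 * m + 4) - (-1) ^ (m + 1) * 3 ^ (3 * m + 2) := by
  obtain ⟨ω, hω⟩ := exists_sq_add_self_add_one_eq_zero
  have hsq : (3 * (1 + 2 * ω)) ^ 2 = -27 := by linear_combination 36 * hω
  have h := nine_mul_CB_eq hω (2 * m + 2) (by omega)
  rw [show 2 * m + 2 = 2 * (m + 1) by ring, pow_mul (-_), neg_sq, pow_mul (3 * (1 + 2 * ω)), hsq,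
    neg_pow 27, show (27 : ℂ) = 3 ^ 3 by norm_num, ← pow_mul, ← pow_mul] at h
  rw [show 2 * m + 2 = 2 * (m + 1) by ring]
  have h' : (CB (2 * (m + 1)) : ℂ) = 3 ^ (6 * m + 4) - (-1) ^ (m + 1) * 3 ^ (3 * m + 2) := by
    linear_combination (1 / 9 : ℂ) * h + (1 / 3 : ℂ) * (-1) ^ (m + 1) * 3 ^ (3 * (m + 1)) * hω
  exact_mod_cast h'

lemma CB_two_mul_add_one (m : ℕ) :
    (CB (2 * m + 1) : ℤ) = 3 ^ (6 * m + 1) - (-1) ^ (m + 1) * 3 ^ (3 * m + 1) := by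
  obtain ⟨ω, hω⟩ := exists_sq_add_self_add_one_eq_zero
  have hsq : (3 * (1 + 2 * ω)) ^ 2 = -27 := by linear_combination 36 * hω
  have h := nine_mul_CB_eq hω (2 * m + 1) (by omega)
  rw [pow_succ (-_), pow_succ (3 * (1 + 2 * ω)), pow_mul (-_), neg_sq, pow_mul (3 * (1 + 2 * ω)),
    hsq, neg_pow 27, show (27 : ℂ) = 3 ^ 3 by norm_num, ← pow_mul, ← pow_mul] at h
  have h' : (CB (2 * m + 1) : ℂ) = 3 ^ (6 * m + 1) - (-1) ^ (m + 1) * 3 ^ (3 * m + 1) := by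
    linear_combination (1 / 9 : ℂ) * h + (-1) ^ m * 3 ^ (3 * m) * (2 * ω - 3) * hω
  exact_mod_cast h'

lemma sqrt_three_mul_cpow_half : (Real.sqrt 3 : ℂ) * (3 : ℂ) ^ (1 / 2 : ℂ) = 3 := by
  have h : ((Real.sqrt 3 : ℝ) : ℂ) = (3 : ℂ) ^ (1 / 2 : ℂ) := by
    rw [Real.sqrt_eq_rpow, Complex.ofReal_cpow (by norm_num)]
    norm_num
  rw [← h]
  exact_mod_cast Real.mul_self_sqrt (show (0 : ℝ) ≤ 3 by norm_num)

theorem stmt_1 (n : ℕ) (hn : 1 ≤ n) :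
    (CB n : ℂ) = 3 ^ (3 * n - 2) -
      ((1 + (-1 : ℂ) ^ n) + Complex.I * Real.sqrt 3 * (1 - (-1 : ℂ) ^ n)) *
        (Complex.I ^ n / 2) * (3 : ℂ) ^ ((3 * (n : ℂ) - 2) / 2) ∧
    (Even n →
      (CB n : ℤ) = 3 ^ (3 * n - 2) - (-1) ^ (n / 2) * 3 ^ ((3 * n - 2) / 2)) ∧
    (Odd n →
      (CB n : ℤ) = 3 ^ (3 * n - 2) - (-1) ^ ((n + 1) / 2) * 3 ^ ((3 * n - 1) / 2)) := by
  rcases Nat.even_or_odd' n with ⟨m, rfl | rfl⟩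
  · obtain ⟨m, rfl⟩ : ∃ k, m = k + 1 := ⟨m - 1, by omega⟩
    have key := CB_two_mul_add_two m
    rw [show 2 * m + 2 = 2 * (m + 1) by ring] at key
    refine ⟨?_, fun _ => ?_, fun h => absurd h (by simp)⟩
    · have hc : (CB (2 * (m + 1)) : ℂ) =
          3 ^ (6 * m + 4) - (-1) ^ (m + 1) * 3 ^ (3 * m + 2) := by exact_mod_cast key
      rw [hc, show 3 * (2 * (m + 1)) - 2 = 6 * m + 4 by omega,
        show (3 * ((2 * (m + 1) : ℕ) : ℂ) - 2) / 2 = ((3 * m + 2 : ℕ) : ℂ) by push_cast; ring,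
        Complex.cpow_natCast, pow_mul, pow_mul, Complex.I_sq]
      norm_num
      ring
    · rw [key, show 3 * (2 * (m + 1)) - 2 = 6 * m + 4 by omega,
        show (6 * m + 4) / 2 = 3 * m + 2 by omega, show 2 * (m + 1) / 2 = m + 1 by omega]
  · have key := CB_two_mul_add_one m
    refine ⟨?_, fun h => absurd h (by simp), fun _ => ?_⟩
    · have hc : (CB (2 * m + 1) : ℂ) =
          3 ^ (6 * m + 1) - (-1) ^ (m + 1) * 3 ^ (3 * m + 1) := by exact_mod_cast key
      rw [hc, show 3 * (2 * m + 1) - 2 = 6 * m + 1 by omega,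
        show (3 * ((2 * m + 1 : ℕ) : ℂ) - 2) / 2 = ((3 * m : ℕ) : ℂ) + 1 / 2 by push_cast; ring,
        Complex.cpow_add _ _ (by norm_num), Complex.cpow_natCast, pow_succ (-1 : ℂ) (2 * m),
        pow_succ Complex.I (2 * m), pow_mul (-1 : ℂ), pow_mul Complex.I, Complex.I_sq, neg_one_sq,
        one_pow]
      linear_combination -(-1) ^ m * 3 ^ (3 * m) * sqrt_three_mul_cpow_half +
        (-1) ^ m * 3 ^ (3 * m) * ((Real.sqrt 3 : ℂ) * (3 : ℂ) ^ (1 / 2 : ℂ)) * Complex.I_sq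
    · rw [key, show 3 * (2 * m + 1) - 2 = 6 * m + 1 by omega,
        show (3 * (2 * m + 1) - 1) / 2 = 3 * m + 1 by omega,
        show (2 * m + 1 + 1) / 2 = m + 1 by omega]
end

section
/- For every real number x with |x| < 1/27, the power series Σ_{n=0}^∞ C_A(n)·x^n converges and equals (162x³ − 9x² + 24x − 1) / ((27x − 1)·(27x² + 1)). -/
open Nat Finset

/-- `CA n` is the number of words of length `3n` over a three-letter alphabet in which
each letter occurs a number of times divisible by 3:
the sum over triples `k1 + k2 + k3 = n` of `(3n)! / ((3k1)! (3k2)! (3k3)!)`. -/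
def CA (n : ℕ) : ℕ :=
  ∑ k ∈ Finset.Nat.antidiagonalTuple 3 n,
    (3 * n)! / ((3 * k 0)! * (3 * k 1)! * (3 * k 2)!)

theorem sum_antidiagonalTuple_three {M : Type*} [AddCommMonoid M] (n : ℕ) (f : ℕ → ℕ → ℕ → M) :
    ∑ k ∈ Finset.Nat.antidiagonalTuple 3 n, f (k 0) (k 1) (k 2) =
      ∑ p ∈ antidiagonal n, ∑ q ∈ antidiagonal p.2, f p.1 q.1 q.2 := by
  rw [Finset.sum_sigma']
  refine Finset.sum_bij' (fun k _ => ⟨(k 0, k 1 + k 2), (k 1, k 2)⟩)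
    (fun s _ => ![s.1.1, s.2.1, s.2.2]) ?_ ?_ ?_ ?_ ?_
  · intro k hk
    simp only [Finset.Nat.mem_antidiagonalTuple, Fin.sum_univ_three] at hk
    simp only [Finset.mem_sigma, HasAntidiagonal.mem_antidiagonal, and_true]
    omega
  · rintro ⟨⟨a, b⟩, c, d⟩ h
    simp only [Finset.mem_sigma, HasAntidiagonal.mem_antidiagonal] at h
    simp [Finset.Nat.mem_antidiagonalTuple, Fin.sum_univ_three]
    omega
  · intro k _
    ext i
    fin_cases i <;> rfl
  · rintro ⟨⟨a, b⟩, c, d⟩ h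
    simp only [Finset.mem_sigma, HasAntidiagonal.mem_antidiagonal] at h
    obtain ⟨-, rfl⟩ := h
    rfl
  · intro k _
    rfl

theorem factorial_div_three_factorials (a b c : ℕ) :
    (a + b + c)! / (a ! * b ! * c !) = (a + b + c).choose a * (b + c).choose b := by
  refine Nat.div_eq_of_eq_mul_left (by positivity) ?_
  rw [add_assoc, ← Nat.add_choose_mul_factorial_mul_factorial a (b + c),
    ← Nat.add_choose_mul_factorial_mul_factorial b c, Nat.choose_symm_add, Nat.choose_symm_add]
  ring

theorem CA_eq_sum_choose (n : ℕ) :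
    CA n = ∑ k ∈ range (n + 1), (3 * n).choose (3 * k) *
      ∑ j ∈ range (k + 1), (3 * k).choose (3 * j) := by
  have h := sum_antidiagonalTuple_three n
    (fun a b c => (3 * n)! / ((3 * a)! * (3 * b)! * (3 * c)!))
  rw [CA, h, ← Finset.Nat.sum_antidiagonal_swap, Finset.Nat.sum_antidiagonal_eq_sum_range_succ_mk]
  refine Finset.sum_congr rfl fun k hk => ?_
  have hk : k ≤ n := Nat.lt_succ_iff.mp (mem_range.mp hk)
  simp only [Prod.swap_prod_mk]
  rw [Finset.Nat.sum_antidiagonal_eq_sum_range_succ_mk, Finset.mul_sum]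
  refine Finset.sum_congr rfl fun j hj => ?_
  have hj : j ≤ k := Nat.lt_succ_iff.mp (mem_range.mp hj)
  have e := factorial_div_three_factorials (3 * (n - k)) (3 * j) (3 * (k - j))
  rw [show 3 * (n - k) + 3 * j + 3 * (k - j) = 3 * n by omega,
    show 3 * j + 3 * (k - j) = 3 * k by omega] at e
  rw [e, Nat.choose_symm_of_eq_add (show 3 * n = 3 * (n - k) + 3 * k by omega)]

theorem sum_range_three_mul_succ {M : Type*} [AddCommMonoid M] (f : ℕ → M)
    (h : ∀ m, ¬ 3 ∣ m → f m = 0) (n : ℕ) :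
    ∑ m ∈ range (3 * n + 1), f m = ∑ k ∈ range (n + 1), f (3 * k) := by
  induction n with
  | zero => simp
  | succ n ih =>
    rw [show 3 * (n + 1) + 1 = 3 * n + 1 + 1 + 1 + 1 by ring, sum_range_succ, sum_range_succ,
      sum_range_succ, ih, sum_range_succ _ (n + 1), h (3 * n + 1) (by omega),
      h (3 * n + 1 + 1) (by omega), add_zero, add_zero]
    rfl

section CubeRoot

variable {R : Type*} [CommRing R] {w : R}

theorem cube_eq_one_of_root (hw : w ^ 2 + w + 1 = 0) : w ^ 3 = 1 := by
  linear_combination (w - 1) * hw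

theorem one_add_pow_add_sq_pow (hw : w ^ 2 + w + 1 = 0) (m : ℕ) :
    1 + w ^ m + (w ^ 2) ^ m = if 3 ∣ m then 3 else 0 := by
  have h3 := cube_eq_one_of_root hw
  have hq (q : ℕ) : w ^ (3 * q) = 1 := by rw [pow_mul, h3, one_pow]
  rw [← pow_mul, mul_comm 2 m, pow_mul]
  obtain ⟨q, rfl | rfl | rfl⟩ : ∃ q, m = 3 * q ∨ m = 3 * q + 1 ∨ m = 3 * q + 2 :=
    ⟨m / 3, by omega⟩
  · rw [if_pos (by omega), hq]
    ring
  · rw [if_neg (by omega), pow_succ, hq]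
    linear_combination hw
  · rw [if_neg (by omega), pow_add, hq]
    linear_combination hw + w * h3

theorem three_mul_sum_choose_three_mul (hw : w ^ 2 + w + 1 = 0) (a : R) (n : ℕ) :
    3 * ∑ k ∈ range (n + 1), ((3 * n).choose (3 * k) : R) * (a ^ 3) ^ k =
      ((1 + a) ^ 3) ^ n + ((1 + w * a) ^ 3) ^ n + ((1 + w ^ 2 * a) ^ 3) ^ n := by
  have h := sum_range_three_mul_succ
    (fun m => a ^ m * ((3 * n).choose m : R) * (1 + w ^ m + (w ^ 2) ^ m))
    (fun m hm => by simp [one_add_pow_add_sq_pow hw, hm]) n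
  have expand (b : R) : ((1 + b) ^ 3) ^ n =
      ∑ m ∈ range (3 * n + 1), b ^ m * ((3 * n).choose m : R) := by
    rw [← pow_mul, add_comm, add_pow]
    simp only [one_pow, mul_one]
  rw [expand, expand, expand, ← sum_add_distrib, ← sum_add_distrib, mul_sum]
  refine Eq.trans ?_ (h.symm.trans (sum_congr rfl fun m _ => by rw [mul_pow, mul_pow]; ring))
  refine sum_congr rfl fun k _ => ?_
  simp only [one_add_pow_add_sq_pow hw, dvd_mul_right, if_true]
  ring

theorem nine_mul_CA (hw : w ^ 2 + w + 1 = 0) (n : ℕ) :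
    9 * (CA n : R) =
      27 ^ n + 2 * 0 ^ n + 3 * ((3 * (1 + 2 * w)) ^ n + (-(3 * (1 + 2 * w))) ^ n) := by
  have h3 := cube_eq_one_of_root hw
  have inner (k : ℕ) : 3 * ∑ j ∈ range (k + 1), ((3 * k).choose (3 * j) : R) =
      (2 ^ 3) ^ k + 2 * ((-1) ^ 3) ^ k := by
    have h := three_mul_sum_choose_three_mul hw 1 k
    simp only [one_pow, mul_one] at h
    rw [h, show (1 + w) ^ 3 = (-1) ^ 3 by linear_combination (w + 2) * hw,
      show (1 + w ^ 2) ^ 3 = (-1) ^ 3 by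
        linear_combination (w ^ 4 - w ^ 3 + 3 * w ^ 2 - 2 * w + 2) * hw]
    ring
  have h2 := three_mul_sum_choose_three_mul hw 2 n
  have hm := three_mul_sum_choose_three_mul hw (-1) n
  rw [show ((1 : R) + 2) ^ 3 = 27 by norm_num,
    show (1 + w * 2) ^ 3 = -(3 * (1 + 2 * w)) by linear_combination (8 * w + 4) * hw,
    show (1 + w ^ 2 * 2) ^ 3 = 3 * (1 + 2 * w) by
      linear_combination 12 * w * h3 + 8 * (w ^ 3 + 1) * h3 + 6 * hw] at h2
  rw [show ((1 : R) + -1) ^ 3 = 0 by norm_num,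
    show (1 + w * -1) ^ 3 = -(3 * (1 + 2 * w)) by linear_combination 3 * hw - h3,
    show (1 + w ^ 2 * -1) ^ 3 = 3 * (1 + 2 * w) by
      linear_combination 3 * w * h3 - (w ^ 3 + 1) * h3 - 3 * hw] at hm
  have hsum : 3 * (CA n : R) =
      ∑ k ∈ range (n + 1), ((3 * n).choose (3 * k) : R) * (2 ^ 3) ^ k +
        2 * ∑ k ∈ range (n + 1), ((3 * n).choose (3 * k) : R) * ((-1) ^ 3) ^ k := by
    rw [CA_eq_sum_choose, mul_sum _ _ 2, ← sum_add_distrib]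
    push_cast
    rw [mul_sum]
    refine sum_congr rfl fun k _ => ?_
    linear_combination ((3 * n).choose (3 * k) : R) * inner k
  linear_combination 3 * hsum + h2 + 2 * hm

end CubeRoot

theorem stmt_5 (x : ℝ) (hx : |x| < 1 / 27) :
    HasSum (fun n : ℕ => (CA n : ℝ) * x ^ n)
      ((162 * x ^ 3 - 9 * x ^ 2 + 24 * x - 1) / ((27 * x - 1) * (27 * x ^ 2 + 1))) := by
  obtain ⟨w, hw⟩ : ∃ w : ℂ, w ^ 2 + w + 1 = 0 := by
    have h := (Complex.isPrimitiveRoot_exp 3 (by norm_num)).geom_sum_eq_zero (by norm_num)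
    refine ⟨Complex.exp (2 * Real.pi * Complex.I / (3 : ℕ)), Eq.trans ?_ h⟩
    simp only [sum_range_succ, sum_range_zero]
    ring
  set c : ℂ := 3 * (1 + 2 * w) with hc
  have hc2 : c ^ 2 = -27 := by
    rw [hc]
    linear_combination 36 * hw
  have hcn : ‖c‖ ^ 2 = 27 := by
    rw [← norm_pow, hc2]
    norm_num
  have hcx : ‖c * x‖ < 1 := by
    rw [norm_mul, Complex.norm_real, Real.norm_eq_abs]
    nlinarith [norm_nonneg c, abs_nonneg x]
  have hx27 : ‖(27 * x : ℂ)‖ < 1 := by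
    rw [norm_mul, Complex.norm_real, Real.norm_eq_abs]
    norm_num
    linarith
  have h1 := hasSum_geometric_of_norm_lt_one hx27
  have h0 := hasSum_geometric_of_norm_lt_one (show ‖(0 : ℂ)‖ < 1 by simp)
  have hp := hasSum_geometric_of_norm_lt_one hcx
  have hm := hasSum_geometric_of_norm_lt_one (show ‖-(c * x)‖ < 1 by rwa [norm_neg])
  have hne {z : ℂ} (hz : ‖z‖ < 1) : 1 - z ≠ 0 := by
    intro h
    rw [← sub_eq_zero.mp h] at hz
    simp at hz
  have d1 := hne hx27
  have d1' : 27 * (x : ℂ) - 1 ≠ 0 := by rw [← neg_sub]; exact neg_ne_zero.mpr d1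
  have dp := hne hcx
  have dm : 1 - -(c * x) ≠ 0 := hne (by rwa [norm_neg])
  have hprod : (1 - c * x) * (1 - -(c * x)) = 27 * x ^ 2 + 1 := by
    linear_combination -(x : ℂ) ^ 2 * hc2
  have hpm : (1 - c * x)⁻¹ + (1 - -(c * x))⁻¹ = 2 / (27 * x ^ 2 + 1 : ℂ) := by
    rw [← hprod]
    field_simp
    ring
  have d2 : (27 * x ^ 2 + 1 : ℂ) ≠ 0 := hprod ▸ mul_ne_zero dp dm
  rw [← Complex.hasSum_ofReal]
  convert (((h1.add (h0.mul_left 2)).add ((hp.add hm).mul_left 3)).mul_left (1 / 9)) using 1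
  · rfl
  · funext n
    push_cast
    have h := nine_mul_CA hw n
    rw [← hc] at h
    have h00 : (0 : ℂ) ^ n * x ^ n = 0 ^ n := by
      rw [← mul_pow, zero_mul]
    clear_value c
    rw [← neg_mul, mul_pow, mul_pow, mul_pow]
    linear_combination (1 / 9) * (x : ℂ) ^ n * h + (2 / 9) * h00
  · rw [hpm, ← neg_sub (27 * (x : ℂ)) 1, inv_neg, sub_zero, inv_one]
    push_cast
    rw [div_eq_iff (mul_ne_zero d1' d2)]
    linear_combination (1 / 9) * (27 * (x : ℂ) ^ 2 + 1) * mul_inv_cancel₀ d1' -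
      (6 / 9) * (27 * (x : ℂ) - 1) * mul_inv_cancel₀ d2
end

section
/- For every real number x with |x| < 1/27, the power series Σ_{n=0}^∞ C_D(n)·x^n converges and equals 18x / (1 − 27x). -/
open Nat Finset

/-- `CD n` is the number of words of length `3n` over a three-letter alphabet in which
the three letters occur numbers of times congruent to 0, 1, 2 mod 3 in some order:
`6` times the sum over triples `k1 + k2 + k3 = n - 1` of
`(3n)! / ((3k1)! (3k2+1)! (3k3+2)!)`, with `CD 0 = 0`. -/
def CD (n : ℕ) : ℕ :=
  if n = 0 then 0 else
    6 * ∑ k ∈ Finset.Nat.antidiagonalTuple 3 (n - 1),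
      (3 * n)! / ((3 * k 0)! * (3 * k 1 + 1)! * (3 * k 2 + 2)!)

lemma pow_cube_root {w : ℂ} (hw : 1 + w + w ^ 2 = 0) (m : ℕ) : w ^ m = w ^ (m % 3) := by
  have h3 : w ^ 3 = 1 := by linear_combination (w - 1) * hw
  conv_lhs => rw [← Nat.div_add_mod m 3, pow_add, pow_mul, h3, one_pow, one_mul]

lemma sum_pow_cube_root {w : ℂ} (hw : 1 + w + w ^ 2 = 0) (m : ℕ) :
    ∑ i ∈ range 3, (w ^ i) ^ m = if m % 3 = 0 then 3 else 0 := by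
  have h : ∀ i : ℕ, (w ^ i) ^ m = (w ^ (m % 3)) ^ i := fun i => by
    rw [← pow_mul, mul_comm, pow_mul, pow_cube_root hw m]
  simp only [h, sum_range_succ, sum_range_zero]
  have hlt := Nat.mod_lt m (show 3 > 0 by norm_num)
  interval_cases m % 3
  · norm_num
  · norm_num
    linear_combination hw
  · norm_num
    linear_combination (w ^ 2 - w + 1) * hw

/-- The trinomial coefficients with entries congruent to `0, 1, 2` modulo `3`, summed by
a roots of unity filter. -/
lemma sum_filter_multinomial (n : ℕ) :
    ∑ k ∈ (piAntidiag (univ : Finset (Fin 3)) (3 * (n + 1))).filter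
        (fun k => k 1 % 3 = 1 ∧ k 2 % 3 = 2), Nat.multinomial univ k = 3 * 27 ^ n := by
  obtain ⟨w, hw⟩ : ∃ w : ℂ, 1 + w + w ^ 2 = 0 := by
    have h := (Complex.isPrimitiveRoot_exp 3 (by norm_num)).geom_sum_eq_zero (by norm_num)
    exact ⟨_, by simpa [sum_range_succ] using h⟩
  have h3 : w ^ 3 = 1 := by linear_combination (w - 1) * hw
  have expand : ∀ i j : ℕ, (w ^ i) ^ 2 * w ^ j * (1 + w ^ i + w ^ j) ^ (3 * (n + 1)) =
      ∑ k ∈ piAntidiag (univ : Finset (Fin 3)) (3 * (n + 1)),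
        (Nat.multinomial univ k : ℂ) * ((w ^ i) ^ (k 1 + 2) * (w ^ j) ^ (k 2 + 1)) := by
    intro i j
    have h := Finset.sum_pow_eq_sum_piAntidiag (univ : Finset (Fin 3)) ![1, w ^ i, w ^ j]
      (3 * (n + 1))
    simp only [Fin.sum_univ_three, Fin.prod_univ_three, Matrix.cons_val_zero,
      Matrix.cons_val_one, Matrix.cons_val, one_pow, one_mul] at h
    rw [h, mul_sum]
    refine sum_congr rfl fun k _ => ?_
    ring
  have filtered : ∑ i ∈ range 3, ∑ j ∈ range 3,
      (w ^ i) ^ 2 * w ^ j * (1 + w ^ i + w ^ j) ^ (3 * (n + 1)) =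
      9 * ∑ k ∈ (piAntidiag (univ : Finset (Fin 3)) (3 * (n + 1))).filter
        (fun k => k 1 % 3 = 1 ∧ k 2 % 3 = 2), (Nat.multinomial univ k : ℂ) := by
    simp only [expand]
    rw [sum_congr rfl fun i _ => sum_comm, sum_comm, sum_filter, mul_sum]
    refine sum_congr rfl fun k _ => ?_
    simp only [← mul_sum, ← sum_mul, sum_pow_cube_root hw]
    split_ifs <;> first | omega | norm_num
    ring
  have evaluated : ∑ i ∈ range 3, ∑ j ∈ range 3,
      (w ^ i) ^ 2 * w ^ j * (1 + w ^ i + w ^ j) ^ (3 * (n + 1)) = 27 ^ (n + 1) := by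
    have h1 : (1 + 1 + w) ^ 3 = 3 + 6 * w := by linear_combination h3 + 6 * hw
    have h2 : (1 + w + 1) ^ 3 = 3 + 6 * w := by linear_combination h1
    have h4 : (1 + w ^ 2 + w ^ 2) ^ 3 = 3 + 6 * w := by
      linear_combination (8 * w ^ 4 - 8 * w ^ 3 + 12 * w ^ 2 - 4 * w - 2) * hw
    have h5 : (1 + w + w) ^ 3 = -(3 + 6 * w) := by linear_combination 8 * h3 + 12 * hw
    have h6 : (1 + 1 + w ^ 2) ^ 3 = -(3 + 6 * w) := by
      linear_combination (w ^ 4 - w ^ 3 + 6 * w ^ 2 - 5 * w + 11) * hw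
    have h7 : (1 + w ^ 2 + 1) ^ 3 = -(3 + 6 * w) := by linear_combination h6
    have h8 : 1 + w ^ 2 + w = 0 := by linear_combination hw
    simp only [sum_range_succ, sum_range_zero, pow_zero, pow_one, pow_mul, h1, h2, h4, h5, h6,
      h7, h8, hw]
    rw [zero_pow three_ne_zero, zero_pow n.succ_ne_zero,
      show ((1 : ℂ) + 1 + 1) ^ 3 = 27 by norm_num]
    generalize (3 + 6 * w) ^ (n + 1) = u
    generalize (-(3 + 6 * w)) ^ (n + 1) = v
    linear_combination (u * (1 + (w ^ 3 + 1) * (w - 1)) + v * w ^ 2) * hw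
  have h := filtered.symm.trans evaluated
  have h' : (9 : ℂ) * ∑ k ∈ (piAntidiag (univ : Finset (Fin 3)) (3 * (n + 1))).filter
        (fun k => k 1 % 3 = 1 ∧ k 2 % 3 = 2), (Nat.multinomial univ k : ℂ) =
        9 * (3 * 27 ^ n) := by rw [h]; ring
  exact_mod_cast mul_left_cancel₀ (by norm_num) h'

lemma CD_succ (n : ℕ) : CD (n + 1) = 18 * 27 ^ n := by
  have h : ∑ k ∈ Finset.Nat.antidiagonalTuple 3 n,
      (3 * (n + 1))! / ((3 * k 0)! * (3 * k 1 + 1)! * (3 * k 2 + 2)!) = 3 * 27 ^ n := by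
    rw [← sum_filter_multinomial]
    refine sum_nbij' (fun k => ![3 * k 0, 3 * k 1 + 1, 3 * k 2 + 2])
      (fun k i => k i / 3) ?_ ?_ ?_ ?_ ?_
    · intro k hk
      simp [Finset.Nat.mem_antidiagonalTuple, Fin.sum_univ_three] at hk ⊢
      omega
    · intro k hk
      simp [Finset.Nat.mem_antidiagonalTuple, Fin.sum_univ_three] at hk ⊢
      omega
    · intro k hk
      funext i
      fin_cases i <;> simp <;> omega
    · intro k hk
      simp [Fin.sum_univ_three] at hk
      funext i
      fin_cases i <;> simp <;> omega
    · intro k hk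
      simp [Finset.Nat.mem_antidiagonalTuple, Fin.sum_univ_three] at hk
      simp only [Nat.multinomial, Fin.sum_univ_three, Fin.prod_univ_three, Matrix.cons_val_zero,
        Matrix.cons_val_one, Matrix.cons_val]
      congr 2
      omega
  simp only [CD, Nat.add_one_ne_zero, if_false, Nat.add_sub_cancel, h]
  ring

theorem stmt_8 (x : ℝ) (hx : |x| < 1 / 27) :
    HasSum (fun n : ℕ => (CD n : ℝ) * x ^ n) (18 * x / (1 - 27 * x)) := by
  have hr : |27 * x| < 1 := by
    rw [abs_mul, abs_of_pos (by norm_num : (0 : ℝ) < 27)]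
    linarith
  rw [← hasSum_nat_add_iff' 1]
  have h := (hasSum_geometric_of_abs_lt_one hr).mul_left (18 * x)
  have hterm : (fun n : ℕ => (CD (n + 1) : ℝ) * x ^ (n + 1)) =
      fun n : ℕ => 18 * x * (27 * x) ^ n := by
    funext n
    rw [CD_succ]
    push_cast
    ring
  rw [hterm]
  simpa [CD, div_eq_mul_inv] using h
end

section
/- The sequence C_C satisfies C_C(1) = 0, C_C(2) = 90, C_C(3) = 2268, and for every natural number n ≥ 4, C_C(n) = 27·(C_C(n−1) − C_C(n−2) + 27·C_C(n−3)). -/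
open Nat Finset

/-- `CC n` is the number of words of length `3n` over a three-letter alphabet in which
each letter occurs a number of times congruent to 2 mod 3:
the sum over triples `k1 + k2 + k3 = n - 2` of `(3n)! / ((3k1+2)! (3k2+2)! (3k3+2)!)`,
with `CC 0 = CC 1 = 0`. -/
def CC (n : ℕ) : ℕ :=
  if n ≤ 1 then 0 else
    ∑ k ∈ Finset.Nat.antidiagonalTuple 3 (n - 2),
      (3 * n)! / ((3 * k 0 + 2)! * (3 * k 1 + 2)! * (3 * k 2 + 2)!)

/-- The roots-of-unity filter for a cube root of unity, selecting the exponents congruent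
to 2 mod 3. -/
lemma sum_pow_mul_succ_eq_ite {R : Type*} [CommRing R] {w : R} (hw : w ^ 2 + w + 1 = 0) (k : ℕ) :
    ∑ j : Fin 3, w ^ (j : ℕ) * (w ^ (j : ℕ)) ^ k = if k % 3 = 2 then 3 else 0 := by
  have h3 : w ^ 3 = 1 := by linear_combination (w - 1) * hw
  have hk : w ^ k = w ^ (k % 3) := by
    conv_lhs => rw [← Nat.div_add_mod k 3, pow_add, pow_mul, h3, one_pow, one_mul]
  have hlt : k % 3 < 3 := Nat.mod_lt _ (by norm_num)
  have hk2 : (w ^ 2) ^ k = (w ^ (k % 3)) ^ 2 := by rw [← hk, pow_right_comm]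
  simp only [Fin.sum_univ_three, Fin.val_zero, Fin.val_one, Fin.val_two, pow_zero, one_pow,
    pow_one, one_mul, hk, hk2]
  generalize k % 3 = r at hlt
  interval_cases r
  · simp
    linear_combination hw
  · simp
    linear_combination hw + w * h3
  · simp
    linear_combination (2 + w ^ 3) * h3

/-- The cubes of the sums of three cube roots of unity are among `0`, `27`, `±3√3 i`. -/
lemma sum_cube_roots_annihilator {R : Type*} [CommRing R] {w : R} (hw : w ^ 2 + w + 1 = 0)
    (v : Fin 3 → Fin 3) (s : R) (hs : s = ∑ i, w ^ (v i : ℕ)) :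
    (s ^ 3) * ((s ^ 3) ^ 3 - 27 * (s ^ 3) ^ 2 + 27 * s ^ 3 - 729) = 0 := by
  rw [Fin.sum_univ_three] at hs
  have hcube : s ^ 3 = 0 ∨ s ^ 3 = 27 ∨ s ^ 3 = 3 + 6 * w ∨ s ^ 3 = -(3 + 6 * w) := by
    have hpow : ∀ a : Fin 3, w ^ (a : ℕ) = 1 ∨ w ^ (a : ℕ) = w ∨ w ^ (a : ℕ) = -1 - w := by
      intro a
      fin_cases a
      · exact .inl (pow_zero w)
      · exact .inr (.inl (pow_one w))
      · exact .inr (.inr (show w ^ 2 = -1 - w by linear_combination hw))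
    rcases hpow (v 0) with h0 | h0 | h0 <;> rcases hpow (v 1) with h1 | h1 | h1 <;>
      rcases hpow (v 2) with h2 | h2 | h2 <;> rw [h0, h1, h2] at hs <;>
      subst hs <;> clear h0 h1 h2 hpow <;>
      first
      | (left; grind)
      | (right; left; grind)
      | (right; right; left; grind)
      | (right; right; right; grind)
  rcases hcube with h | h | h | h <;> rw [h]
  · ring
  · ring
  · grind
  · grind

lemma CC_eq_sum_filter {n : ℕ} (hn : 1 ≤ n) :
    CC n = ∑ k ∈ (piAntidiag (univ : Finset (Fin 3)) (3 * n)).filter (fun k => ∀ i, k i % 3 = 2),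
      Nat.multinomial univ k := by
  rcases hn.eq_or_lt with rfl | hn
  · rw [Finset.sum_eq_zero]
    · simp [CC]
    · intro k hk
      simp only [mem_filter, mem_piAntidiag, Fin.sum_univ_three] at hk
      have := hk.2 0
      have := hk.2 1
      have := hk.2 2
      omega
  · rw [CC, if_neg (by omega)]
    refine sum_nbij' (fun k i => 3 * k i + 2) (fun k i => k i / 3) ?_ ?_ ?_ ?_ ?_
    · intro k hk
      simp only [Finset.Nat.mem_antidiagonalTuple, Fin.sum_univ_three] at hk
      simp only [mem_filter, mem_piAntidiag, Fin.sum_univ_three]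
      refine ⟨⟨by omega, by simp⟩, fun i => by omega⟩
    · intro k hk
      simp only [mem_filter, mem_piAntidiag, Fin.sum_univ_three] at hk
      simp only [Finset.Nat.mem_antidiagonalTuple, Fin.sum_univ_three]
      have := hk.2 0
      have := hk.2 1
      have := hk.2 2
      omega
    · intro k _
      funext i
      dsimp only
      omega
    · intro k hk
      funext i
      have := (mem_filter.mp hk).2 i
      dsimp only
      omega
    · intro k hk
      simp only [Finset.Nat.mem_antidiagonalTuple, Fin.sum_univ_three] at hk
      simp only [Nat.multinomial, Fin.sum_univ_three, Fin.prod_univ_three]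
      congr 2
      omega

lemma CC_eq_sum_cube_roots {R : Type*} [CommRing R] {w : R} (hw : w ^ 2 + w + 1 = 0) {n : ℕ}
    (hn : 1 ≤ n) :
    (27 * CC n : R) =
      ∑ v : Fin 3 → Fin 3, (∏ i, w ^ (v i : ℕ)) * ((∑ i, w ^ (v i : ℕ)) ^ 3) ^ n := by
  simp only [← pow_mul]
  simp only [Finset.sum_pow_eq_sum_piAntidiag, mul_sum]
  rw [sum_comm, CC_eq_sum_filter hn, sum_filter]
  push_cast
  rw [mul_sum]
  refine sum_congr rfl fun k _ => ?_
  have h : ∀ v : Fin 3 → Fin 3, (∏ i, w ^ (v i : ℕ)) *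
      ((Nat.multinomial univ k : R) * ∏ i, (w ^ (v i : ℕ)) ^ k i) =
      Nat.multinomial univ k * ∏ i, (w ^ (v i : ℕ) * (w ^ (v i : ℕ)) ^ k i) := by
    intro v
    rw [prod_mul_distrib]
    ring
  simp only [h]
  rw [← mul_sum, ← Fintype.prod_sum fun i (j : Fin 3) => w ^ (j : ℕ) * (w ^ (j : ℕ)) ^ k i]
  simp only [sum_pow_mul_succ_eq_ite hw]
  split_ifs with hk
  · simp only [hk, if_true, prod_const, Finset.card_univ, Fintype.card_fin]
    ring
  · obtain ⟨i, hi⟩ := not_forall.mp hk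
    rw [prod_eq_zero (mem_univ i) (if_neg hi)]
    simp

lemma exists_complex_sq_add_self_add_one : ∃ w : ℂ, w ^ 2 + w + 1 = 0 := by
  have h := (Complex.isPrimitiveRoot_exp 3 (by norm_num)).geom_sum_eq_zero (by norm_num)
  refine ⟨Complex.exp (2 * Real.pi * Complex.I / 3), Eq.trans ?_ h⟩
  simp only [sum_range_succ, sum_range_zero, Nat.cast_ofNat]
  ring

theorem stmt_15 :
    CC 1 = 0 ∧ CC 2 = 90 ∧ CC 3 = 2268 ∧
    ∀ n : ℕ, 4 ≤ n →
      (CC n : ℤ) = 27 * ((CC (n - 1) : ℤ) - CC (n - 2) + 27 * CC (n - 3)) := by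
  refine ⟨by decide, by rfl, by rfl, fun n hn => ?_⟩
  obtain ⟨m, rfl⟩ := Nat.exists_eq_add_of_le' hn
  obtain ⟨w, hw⟩ := exists_complex_sq_add_self_add_one
  rw [show m + 4 - 1 = m + 3 by omega, show m + 4 - 2 = m + 2 by omega,
    show m + 4 - 3 = m + 1 by omega]
  have h : (27 * CC (m + 4) : ℂ) =
      27 * (27 * CC (m + 3) - 27 * CC (m + 2) + 27 * (27 * CC (m + 1))) := by
    rw [CC_eq_sum_cube_roots hw (by omega), CC_eq_sum_cube_roots hw (by omega),
      CC_eq_sum_cube_roots hw (by omega), CC_eq_sum_cube_roots hw (by omega), mul_sum,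
      ← sum_sub_distrib, ← sum_add_distrib, mul_sum]
    refine sum_congr rfl fun v _ => ?_
    have hv := sum_cube_roots_annihilator hw v _ rfl
    generalize (∑ i, w ^ (v i : ℕ)) ^ 3 = t at hv ⊢
    linear_combination (∏ i, w ^ (v i : ℕ)) * t ^ m * hv
  have h' : (CC (m + 4) : ℂ) = 27 * (CC (m + 3) - CC (m + 2) + 27 * CC (m + 1)) := by
    linear_combination h / 27
  exact_mod_cast h'
end

section
/- The sequence C_D satisfies C_D(1) = 18, and for every natural number n ≥ 2, C_D(n) = 27·C_D(n−1). -/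
open Nat Finset

/-- The weighted count of words of length `N` over the alphabet `ι`, where a word whose letter
multiplicities are `k` has weight `g k`. -/
def wordSum (ι : Type*) [Fintype ι] [DecidableEq ι] (N : ℕ) (g : (ι → ℕ) → ℕ) : ℕ :=
  ∑ k ∈ piAntidiag (univ : Finset ι) N, multinomial univ k * g k

section wordSum

variable {ι : Type*} [Fintype ι]

/-- The linear functional on polynomials sending the monomial with exponent `d` to `g d`. -/
noncomputable def monomialWeight (g : (ι → ℕ) → ℕ) : MvPolynomial ι ℕ →ₗ[ℕ] ℕ :=
  (MvPolynomial.basisMonomials ι ℕ).constr ℕ fun d => g d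

theorem monomialWeight_prod_X_pow (g : (ι → ℕ) → ℕ) (k : ι → ℕ) :
    monomialWeight g (∏ i, (MvPolynomial.X i : MvPolynomial ι ℕ) ^ k i) = g k := by
  have h : ∏ i, (MvPolynomial.X i : MvPolynomial ι ℕ) ^ k i =
      MvPolynomial.basisMonomials ι ℕ (Finsupp.equivFunOnFinite.symm k) := by
    rw [MvPolynomial.coe_basisMonomials]
    beta_reduce
    rw [MvPolynomial.monomial_eq, Finsupp.prod_fintype]
    · simp
    · simp
  rw [h, monomialWeight, Module.Basis.constr_basis]
  rfl

variable [DecidableEq ι]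

theorem monomialWeight_sum_X_pow (g : (ι → ℕ) → ℕ) (N : ℕ) :
    monomialWeight g ((∑ i, MvPolynomial.X i) ^ N) = wordSum ι N g := by
  rw [sum_pow_eq_sum_piAntidiag, map_sum]
  refine sum_congr rfl fun k _ => ?_
  rw [← nsmul_eq_mul, map_nsmul, monomialWeight_prod_X_pow, smul_eq_mul]

theorem wordSum_succ (N : ℕ) (g : (ι → ℕ) → ℕ) :
    wordSum ι (N + 1) g = wordSum ι N fun k => ∑ i, g (k + Pi.single i 1) := by
  rw [← monomialWeight_sum_X_pow, pow_succ, sum_pow_eq_sum_piAntidiag, sum_mul, map_sum]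
  refine sum_congr rfl fun k _ => ?_
  rw [mul_assoc, ← nsmul_eq_mul, map_nsmul, smul_eq_mul, mul_sum, map_sum]
  congr 1
  refine sum_congr rfl fun i _ => ?_
  rw [← monomialWeight_prod_X_pow g (k + Pi.single i 1)]
  congr 1
  simp only [Pi.add_apply, pow_add, prod_mul_distrib]
  congr 1
  rw [prod_eq_single i] <;> simp +contextual

theorem wordSum_const (N c : ℕ) : wordSum ι N (fun _ => c) = Fintype.card ι ^ N * c := by
  have h := sum_pow_eq_sum_piAntidiag (univ : Finset ι) (fun _ => (1 : ℕ)) N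
  simp only [sum_const, smul_eq_mul, mul_one, one_pow, prod_const_one, cast_id] at h
  rw [wordSum, ← sum_mul, ← h, Finset.card_univ]

theorem wordSum_comp_perm (σ : Equiv.Perm ι) (N : ℕ) (g : (ι → ℕ) → ℕ) :
    wordSum ι N (fun k => g (k ∘ σ)) = wordSum ι N g := by
  refine sum_equiv (Equiv.arrowCongr σ.symm (Equiv.refl ℕ)) (fun k => ?_) fun k _ => ?_
  · have h : ∑ i, k (σ i) = ∑ i, k i := Equiv.sum_comp σ k
    simp [mem_piAntidiag, Equiv.arrowCongr, Function.comp_def, h]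
  · have h : ∑ i, k (σ i) = ∑ i, k i := Equiv.sum_comp σ k
    have h' : ∏ i, (k (σ i))! = ∏ i, (k i)! := Equiv.prod_comp σ fun i => (k i)!
    simp [multinomial, Equiv.arrowCongr, Function.comp_def, h, h']

theorem wordSum_sum {κ : Type*} (s : Finset κ) (N : ℕ) (g : κ → (ι → ℕ) → ℕ) :
    wordSum ι N (fun k => ∑ j ∈ s, g j k) = ∑ j ∈ s, wordSum ι N (g j) := by
  simp only [wordSum, mul_sum]
  exact sum_comm

theorem wordSum_congr {N : ℕ} {g h : (ι → ℕ) → ℕ} (H : ∀ k, ∑ i, k i = N → g k = h k) :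
    wordSum ι N g = wordSum ι N h :=
  sum_congr rfl fun k hk => by rw [H k (by simpa using hk)]

end wordSum

/-- The indicator of the letter multiplicities congruent to `(0, 1, 2)` modulo 3. -/
def residueIndicator (k : Fin 3 → ℕ) : ℕ :=
  if (fun i => (k i : ZMod 3)) = ![0, 1, 2] then 1 else 0

/-- A word whose length is `2` modulo `3` has exactly two one-letter extensions whose
multiplicities represent every residue class modulo `3`. -/
theorem sum_residueIndicator_add_single {m : ℕ} {k : Fin 3 → ℕ} (hk : ∑ i, k i = 3 * m + 2) :
    ∑ i, ∑ σ : Equiv.Perm (Fin 3), residueIndicator ((k + Pi.single i 1) ∘ σ) = 2 := by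
  have key : ∀ a b c : ZMod 3, a + b + c = 2 →
      ∑ i : Fin 3, ∑ σ : Equiv.Perm (Fin 3),
        (if (fun j => ![a, b, c] (σ j) + (Pi.single i 1 : Fin 3 → ZMod 3) (σ j)) = ![0, 1, 2]
          then 1 else 0) = 2 := by
    decide +kernel
  have hsum : (k 0 : ZMod 3) + k 1 + k 2 = 2 := by
    rw [Fin.sum_univ_three] at hk
    have h := congrArg (Nat.cast : ℕ → ZMod 3) hk
    push_cast at h
    rw [h, show (3 : ZMod 3) = 0 from rfl]
    simp
  rw [← key _ _ _ hsum]
  refine sum_congr rfl fun i _ => sum_congr rfl fun σ _ => ?_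
  have hcast : (fun j => ((((k + Pi.single i 1 : Fin 3 → ℕ) ∘ σ) j : ℕ) : ZMod 3)) =
      fun j => ![(k 0 : ZMod 3), k 1, k 2] (σ j) + (Pi.single i 1 : Fin 3 → ZMod 3) (σ j) := by
    funext j
    simp only [Function.comp_apply, Pi.add_apply, Nat.cast_add]
    generalize σ j = l
    fin_cases l <;> simp [Pi.single_apply]
  rw [residueIndicator, hcast]

theorem wordSum_residueIndicator (m : ℕ) :
    6 * wordSum (Fin 3) (3 * m + 3) residueIndicator = 3 ^ (3 * m + 2) * 2 := by
  calc 6 * wordSum (Fin 3) (3 * m + 3) residueIndicator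
      = ∑ σ : Equiv.Perm (Fin 3),
          wordSum (Fin 3) (3 * m + 3) fun k => residueIndicator (k ∘ σ) := by
        simp [wordSum_comp_perm, Fintype.card_perm, Nat.factorial]
    _ = wordSum (Fin 3) (3 * m + 2) fun _ => 2 := by
        rw [← wordSum_sum, wordSum_succ]
        exact wordSum_congr fun k hk => sum_residueIndicator_add_single hk
    _ = 3 ^ (3 * m + 2) * 2 := by rw [wordSum_const, Fintype.card_fin]

theorem CD_succ_s16 (m : ℕ) : CD (m + 1) = 6 * wordSum (Fin 3) (3 * m + 3) residueIndicator := by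
  simp only [CD, Nat.add_one_ne_zero, if_false, Nat.add_sub_cancel]
  congr 1
  simp only [wordSum, residueIndicator, mul_ite, mul_one, mul_zero]
  rw [← sum_filter]
  refine sum_bij (fun k _ => ![3 * k 0, 3 * k 1 + 1, 3 * k 2 + 2]) ?_ ?_ ?_ ?_
  · intro k hk
    rw [Finset.Nat.mem_antidiagonalTuple, Fin.sum_univ_three] at hk
    simp only [mem_filter, mem_piAntidiag, Fin.sum_univ_three]
    refine ⟨⟨by simp; omega, by simp⟩, ?_⟩
    have h3 : (3 : ZMod 3) = 0 := rfl
    funext i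
    fin_cases i <;> simp [h3]
  · intro k _ l _ h
    have h0 := congrFun h 0
    have h1 := congrFun h 1
    have h2 := congrFun h 2
    simp at h0 h1 h2
    funext i
    fin_cases i <;> simpa
  · intro k hk
    simp only [mem_filter, mem_piAntidiag, Fin.sum_univ_three] at hk
    obtain ⟨⟨hs, -⟩, hr⟩ := hk
    have h0 : k 0 ≡ 0 [MOD 3] := (ZMod.natCast_eq_natCast_iff _ _ _).1 (congrFun hr 0)
    have h1 : k 1 ≡ 1 [MOD 3] := (ZMod.natCast_eq_natCast_iff _ _ _).1 (congrFun hr 1)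
    have h2 : k 2 ≡ 2 [MOD 3] := (ZMod.natCast_eq_natCast_iff _ _ _).1 (congrFun hr 2)
    simp only [Nat.ModEq] at h0 h1 h2
    refine ⟨fun i => k i / 3, ?_, ?_⟩
    · rw [Finset.Nat.mem_antidiagonalTuple, Fin.sum_univ_three]
      omega
    · funext i
      fin_cases i <;> simp <;> omega
  · intro k hk
    rw [Finset.Nat.mem_antidiagonalTuple, Fin.sum_univ_three] at hk
    rw [multinomial, Fin.sum_univ_three, Fin.prod_univ_three]
    simp only [Matrix.cons_val]
    congr 2
    omega

theorem CD_succ_eq (m : ℕ) : CD (m + 1) = 18 * 27 ^ m := by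
  rw [CD_succ_s16, wordSum_residueIndicator, pow_add, pow_mul]
  norm_num
  ring

theorem stmt_16 :
    CD 1 = 18 ∧ ∀ n : ℕ, 2 ≤ n → CD n = 27 * CD (n - 1) := by
  refine ⟨CD_succ_eq 0, fun n hn => ?_⟩
  obtain ⟨m, rfl⟩ := Nat.exists_eq_add_of_le' hn
  rw [show m + 2 - 1 = m + 1 from rfl, CD_succ_eq m, CD_succ_eq (m + 1), pow_succ]
  ring
end

section
/- For every natural number n ≥ 1, the following identity holds in the complex numbers: C_C(n) = (1/9)·x1^n − ((1 − i·√3)/6)·x2^n − ((1 + i·√3)/6)·x3^n, where x1 = 27, x2 = 3^(3/2)·i, and x3 = −3^(3/2)·i are the three roots of the polynomial x³ − 27(x² − x + 27). -/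
open Nat Finset

/-- A word of length `3n` in which the first two letters occur `2 mod 3` times is counted by `CC n`:
the third letter then also occurs `2 mod 3` times. -/
theorem CC_eq_sum_multinomial (n : ℕ) :
    CC n = ∑ k ∈ (Finset.piAntidiag (univ : Finset (Fin 3)) (3 * n)) with
      k 0 % 3 = 2 ∧ k 1 % 3 = 2, Nat.multinomial univ k := by
  unfold CC
  split_ifs with hn
  · symm
    apply Finset.sum_eq_zero
    intro k hk
    simp only [Finset.mem_filter, Finset.mem_piAntidiag, Fin.sum_univ_three] at hk
    lia
  · refine Finset.sum_nbij' (fun k i => 3 * k i + 2) (fun k i => k i / 3) ?_ ?_ ?_ ?_ ?_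
    · intro k hk
      simp only [Finset.Nat.mem_antidiagonalTuple, Fin.sum_univ_three] at hk
      simp only [Finset.mem_filter, Finset.mem_piAntidiag, Fin.sum_univ_three]
      refine ⟨⟨by lia, by simp⟩, by lia, by lia⟩
    · intro k hk
      simp only [Finset.mem_filter, Finset.mem_piAntidiag, Fin.sum_univ_three] at hk
      simp only [Finset.Nat.mem_antidiagonalTuple, Fin.sum_univ_three]
      lia
    · intro k _
      funext i
      lia
    · intro k hk
      simp only [Finset.mem_filter, Finset.mem_piAntidiag, Fin.sum_univ_three] at hk
      funext i
      fin_cases i <;> simp <;> lia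
    · intro k hk
      simp only [Finset.Nat.mem_antidiagonalTuple, Fin.sum_univ_three] at hk
      have hsum : 3 * k 0 + 2 + (3 * k 1 + 2) + (3 * k 2 + 2) = 3 * n := by lia
      simp only [Nat.multinomial, Fin.sum_univ_three, Fin.prod_univ_three, hsum]

theorem IsPrimitiveRoot.sum_pow_mul_succ {ω : ℂ} (hω : IsPrimitiveRoot ω 3) (m : ℕ) :
    ∑ j ∈ range 3, ω ^ (j * (m + 1)) = if m % 3 = 2 then 3 else 0 := by
  have hgeom : 1 + ω + ω ^ 2 = 0 := by
    simpa [Finset.sum_range_succ] using hω.geom_sum_eq_zero (by norm_num)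
  have h3 : ω ^ 3 = 1 := hω.pow_eq_one
  have hmod (j : ℕ) : ω ^ (j * (m + 1)) = ω ^ (j * (m % 3 + 1)) := by
    exact pow_eq_pow_of_modEq ((Nat.mod_modEq m 3).symm.add_right 1 |>.mul_left j) h3
  simp only [hmod]
  have hlt : m % 3 < 3 := Nat.mod_lt _ (by norm_num)
  generalize m % 3 = r at hlt ⊢
  interval_cases r
  · simpa [Finset.sum_range_succ] using hgeom
  · simp [Finset.sum_range_succ]
    linear_combination hgeom + ω * h3
  · simp [Finset.sum_range_succ]
    linear_combination (ω ^ 3 + 2) * h3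

/-- The roots of unity filter for `CC n`. -/
theorem IsPrimitiveRoot.nine_mul_CC {ω : ℂ} (hω : IsPrimitiveRoot ω 3) (n : ℕ) :
    9 * (CC n : ℂ) =
      ∑ j ∈ range 3, ∑ l ∈ range 3, ω ^ (j + l) * (ω ^ j + ω ^ l + 1) ^ (3 * n) := by
  have hexp (j l : ℕ) : ω ^ (j + l) * (ω ^ j + ω ^ l + 1) ^ (3 * n) =
      ∑ k ∈ Finset.piAntidiag (univ : Finset (Fin 3)) (3 * n),
        (Nat.multinomial univ k : ℂ) * (ω ^ (j * (k 0 + 1)) * ω ^ (l * (k 1 + 1))) := by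
    have h := Finset.sum_pow_eq_sum_piAntidiag (univ : Finset (Fin 3)) ![ω ^ j, ω ^ l, 1] (3 * n)
    simp only [Fin.sum_univ_three, Fin.prod_univ_three, Matrix.cons_val] at h
    rw [h, Finset.mul_sum]
    refine Finset.sum_congr rfl fun k _ => ?_
    ring
  simp only [hexp]
  simp_rw [Finset.sum_comm (s := range 3) (t := Finset.piAntidiag _ _), ← Finset.mul_sum,
    ← Finset.sum_mul, hω.sum_pow_mul_succ]
  rw [CC_eq_sum_multinomial, Finset.sum_filter, Nat.cast_sum, Finset.mul_sum]
  refine Finset.sum_congr rfl fun k _ => ?_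
  by_cases h0 : k 0 % 3 = 2 <;> by_cases h1 : k 1 % 3 = 2 <;> simp [h0, h1]
  ring

theorem stmt_19 (n : ℕ) (hn : 1 ≤ n) :
    let x1 : ℂ := 27
    let x2 : ℂ := 3 * Real.sqrt 3 * Complex.I
    let x3 : ℂ := -(3 * Real.sqrt 3 * Complex.I)
    (x1 ^ 3 - 27 * (x1 ^ 2 - x1 + 27) = 0) ∧
    (x2 ^ 3 - 27 * (x2 ^ 2 - x2 + 27) = 0) ∧
    (x3 ^ 3 - 27 * (x3 ^ 2 - x3 + 27) = 0) ∧
    (CC n : ℂ) = (1 / 9) * x1 ^ n - ((1 - Complex.I * Real.sqrt 3) / 6) * x2 ^ n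
      - ((1 + Complex.I * Real.sqrt 3) / 6) * x3 ^ n := by
  intro x1 x2 x3
  obtain ⟨t, ht⟩ : ∃ t : ℂ, t = Real.sqrt 3 * Complex.I := ⟨_, rfl⟩
  have ht2 : t ^ 2 = -3 := by
    rw [ht, mul_pow, Complex.I_sq, ← Complex.ofReal_pow, Real.sq_sqrt (by norm_num)]
    norm_num
  have hx2 : x2 = 3 * t := by rw [ht]; ring
  have hx3 : x3 = -(3 * t) := by rw [ht]; ring
  refine ⟨by norm_num [x1], ?_, ?_, ?_⟩
  · rw [hx2]
    linear_combination (27 * t - 243) * ht2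
  · rw [hx3]
    linear_combination (-27 * t - 243) * ht2
  obtain ⟨ω, hω⟩ : ∃ ω : ℂ, ω = (-1 + t) / 2 := ⟨_, rfl⟩
  have htω : t = 2 * ω + 1 := by rw [hω]; ring
  have hgeom : ω ^ 2 + ω + 1 = 0 := by
    rw [htω] at ht2
    linear_combination ht2 / 4
  have hprim : IsPrimitiveRoot ω 3 := by
    rw [← Polynomial.isRoot_cyclotomic_iff, Polynomial.cyclotomic_three]
    simpa using hgeom
  have hfilter := hprim.nine_mul_CC n
  have h0 : (ω + ω ^ 2 + 1) ^ (3 * n) = 0 := by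
    rw [show ω + ω ^ 2 + 1 = 0 by linear_combination hgeom, zero_pow (by lia)]
  have h0' : (ω ^ 2 + ω + 1) ^ (3 * n) = 0 := by
    rw [hgeom, zero_pow (by lia)]
  have e1 : (1 + ω + 1) ^ 3 = x2 := by
    rw [hx2, htω]
    linear_combination (ω + 5) * hgeom
  have e2 : (1 + ω ^ 2 + 1) ^ 3 = x3 := by
    rw [hx3, htω]
    linear_combination (ω ^ 4 - ω ^ 3 + 6 * ω ^ 2 - 5 * ω + 11) * hgeom
  have e3 : (ω + ω + 1) ^ 3 = x3 := by
    rw [hx3, htω]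
    linear_combination (8 * ω + 4) * hgeom
  have e4 : (ω ^ 2 + ω ^ 2 + 1) ^ 3 = x2 := by
    rw [hx2, htω]
    linear_combination (8 * ω ^ 4 - 8 * ω ^ 3 + 12 * ω ^ 2 - 4 * ω - 2) * hgeom
  have e1' : (ω + 1 + 1) ^ 3 = x2 := by rw [← e1]; ring
  have e2' : (ω ^ 2 + 1 + 1) ^ 3 = x3 := by rw [← e2]; ring
  have e0 : ((1 : ℂ) + 1 + 1) ^ 3 = x1 := by norm_num [x1]
  simp only [Finset.sum_range_succ, Finset.sum_range_zero, pow_zero, pow_one, zero_add, add_zero,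
    h0, h0'] at hfilter
  simp only [pow_mul, e0, e1, e1', e2, e2', e3, e4] at hfilter
  have hI : Complex.I * Real.sqrt 3 = 2 * ω + 1 := by rw [← htω, ht]; ring
  rw [hI]
  linear_combination hfilter / 9 + (x3 ^ n / 3 + x2 ^ n * (ω ^ 2 - ω) / 9) * hgeom
end
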